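/- arXiv:2210.08367 — 4 statements merged into one kernel-verified Lean document; each statement's English description precedes it below -/
import Mathlib

section
/- Let κ > 0 and suppose D_XY satisfies the Tsybakov noise condition with parameter β ≥ 0 and constant c ≥ 1. If f̄ : X → ℝ is a measurable function with |f̄(x) − η(x)| ≤ κ for every x ∈ X, then the plug-in classifier h̄(x) := sgn(2·f̄(x) − 1) satisfies err(h̄) − err(h*) ≤ 2·c·κ^(1+β). -/
open MeasureTheory

/-- The plug-in classifier `x ↦ sgn(2 f(x) - 1)`, with `true` encoding `+1`
and `false` encoding `-1`; `sgn t = +1` iff `t ≥ 0`. -/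
noncomputable def plugIn {X : Type*} (f : X → ℝ) : X → Bool :=
  fun x => if (1/2 : ℝ) ≤ f x then true else false

/-- The (standard) error `P_{(x,y) ∼ D_XY}(h(x) ≠ y)` of a classifier `h`. -/
noncomputable def err {X : Type*} [MeasurableSpace X] (μ : Measure (X × Bool))
    (h : X → Bool) : ℝ :=
  (μ {p : X × Bool | h p.1 ≠ p.2}).toReal

/-- `η` is the regression function (conditional probability of label `+1`)
of the joint distribution `μ` on `X × {−1,+1}`. -/
def IsRegFun {X : Type*} [MeasurableSpace X] (μ : Measure (X × Bool)) (η : X → ℝ) : Prop :=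
  Measurable η ∧ (∀ x, η x ∈ Set.Icc (0 : ℝ) 1) ∧
    ∀ A : Set X, MeasurableSet A →
      μ (A ×ˢ ({true} : Set Bool)) = ENNReal.ofReal (∫ x in A, η x ∂μ.fst)

/-- Tsybakov noise condition with parameter `β ≥ 0` and constant `c ≥ 1`. -/
def Tsybakov {X : Type*} [MeasurableSpace X] (μ : Measure (X × Bool)) (η : X → ℝ)
    (β c : ℝ) : Prop :=
  ∀ τ : ℝ, 0 < τ → (μ.fst {x | |η x - 1/2| ≤ τ}).toReal ≤ c * τ ^ β

theorem err_eq_aux {X : Type*} [MeasurableSpace X] (μ : Measure (X × Bool))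
    [IsProbabilityMeasure μ] (η : X → ℝ) (hreg : IsRegFun μ η)
    (etaInt : Integrable η μ.fst)
    (f : X → ℝ) (hf : Measurable f) :
    err μ (plugIn f) = ∫ x, (if (1/2 : ℝ) ≤ f x then 1 - η x else η x) ∂μ.fst := by
  obtain ⟨hη, h01, hA⟩ := hreg
  have hAr : ∀ A : Set X, MeasurableSet A →
      μ.real (A ×ˢ ({true} : Set Bool)) = ∫ x in A, η x ∂μ.fst := by
    intro A hAm
    rw [measureReal_def, hA A hAm, ENNReal.toReal_ofReal]
    exact integral_nonneg fun x => (h01 x).1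
  have hAf : ∀ A : Set X, MeasurableSet A →
      μ.real (A ×ˢ ({false} : Set Bool)) = ∫ x in A, (1 - η x) ∂μ.fst := by
    intro A hAm
    have h1 : μ.real (A ×ˢ ({true} : Set Bool)) + μ.real (A ×ˢ ({false} : Set Bool))
        = μ.fst.real A := by
      rw [← measureReal_union]
      · rw [measureReal_def, measureReal_def, Measure.fst_apply hAm]
        congr 2
        ext ⟨x, b⟩
        cases b <;> simp
      · rw [Set.disjoint_left]
        rintro ⟨x, b⟩ h1 h2
        simp at h1 h2
        simp_all
      · exact hAm.prod (measurableSet_singleton _)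
    rw [integral_sub (integrable_const _) etaInt.integrableOn, ← hAr A hAm]
    simp
    linarith
  have hm : MeasurableSet {x | (1/2 : ℝ) ≤ f x} := measurableSet_le measurable_const hf
  have hset : {p : X × Bool | plugIn f p.1 ≠ p.2} =
      ({x | (1/2 : ℝ) ≤ f x} ×ˢ ({false} : Set Bool)) ∪
      ({x | (1/2 : ℝ) ≤ f x}ᶜ ×ˢ ({true} : Set Bool)) := by
    ext ⟨x, b⟩
    by_cases h : (1/2 : ℝ) ≤ f x <;> cases b <;> simp only [plugIn, Set.mem_ofPred_eq,
      Set.mem_union, Set.mem_prod, Set.mem_compl_iff, Set.mem_singleton_iff, h] <;> simp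
  classical
  have hg : (fun x => if (1/2 : ℝ) ≤ f x then 1 - η x else η x) =
      Set.piecewise {x | (1/2 : ℝ) ≤ f x} (fun x => 1 - η x) η := by
    ext x
    by_cases h : (1/2 : ℝ) ≤ f x
    · simp only [Set.piecewise, Set.mem_ofPred_eq, h, if_true]
    · simp only [Set.piecewise, Set.mem_ofPred_eq, h, if_false]
  have oneSubInt : Integrable (fun x => 1 - η x) μ.fst := (integrable_const _).sub etaInt
  rw [hg, integral_piecewise hm oneSubInt.integrableOn
    etaInt.integrableOn, ← hAf _ hm, ← hAr _ hm.compl, ← measureReal_union]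
  · rw [err, hset, measureReal_def]
  · rw [Set.disjoint_left]
    rintro ⟨x, b⟩ h1 h2
    exact h2.1 h1.1
  · exact hm.compl.prod (measurableSet_singleton _)

/-- under Tsybakov noise, a uniform `κ`-approximation `f̄` of the
regression function `η` yields a plug-in classifier with excess error at most
`2 c κ^(1+β)`. -/
theorem stmt0 {X : Type*} [MeasurableSpace X] (μ : Measure (X × Bool))
    [IsProbabilityMeasure μ] (η : X → ℝ) (hreg : IsRegFun μ η)
    (β c κ : ℝ) (hβ : 0 ≤ β) (hc : 1 ≤ c) (hκ : 0 < κ)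
    (hT : Tsybakov μ η β c)
    (fbar : X → ℝ) (hfmeas : Measurable fbar)
    (happrox : ∀ x, |fbar x - η x| ≤ κ) :
    err μ (plugIn fbar) - err μ (plugIn η) ≤ 2 * c * κ ^ (1 + β) := by
  have hη := hreg.1
  have etaInt : Integrable η μ.fst := by
    refine Integrable.of_bound hη.aestronglyMeasurable 1 (Filter.Eventually.of_forall fun x => ?_)
    have := hreg.2.1 x
    rw [Real.norm_eq_abs, abs_le]
    constructor <;> linarith [this.1, this.2]
  have hI : ∀ f : X → ℝ, Measurable f →
      Integrable (fun x => if (1/2 : ℝ) ≤ f x then 1 - η x else η x) μ.fst := by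
    intro f hf
    have hmf : Measurable (fun x => if (1/2 : ℝ) ≤ f x then 1 - η x else η x) :=
      Measurable.ite (measurableSet_le measurable_const hf) (measurable_const.sub hη) hη
    refine Integrable.of_bound hmf.aestronglyMeasurable 1 (Filter.Eventually.of_forall fun x => ?_)
    have := hreg.2.1 x
    rw [Real.norm_eq_abs, abs_le]
    split_ifs <;> constructor <;> linarith [this.1, this.2]
  rw [err_eq_aux μ η hreg etaInt fbar hfmeas, err_eq_aux μ η hreg etaInt η hη,
    ← integral_sub (hI _ hfmeas) (hI _ hη)]
  have hS : MeasurableSet {x | |η x - 1/2| ≤ κ} :=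
    measurableSet_le (hη.sub_const _).abs measurable_const
  calc _ ≤ ∫ x, Set.indicator {x | |η x - 1/2| ≤ κ} (fun _ => 2 * κ) x ∂μ.fst := by
        refine integral_mono ((hI _ hfmeas).sub (hI _ hη))
          ((integrable_const _).indicator hS) fun x => ?_
        have h := abs_le.1 (happrox x)
        simp only [Set.indicator, Set.mem_ofPred_eq, abs_le]
        split_ifs with h1 h2 h3 h3 h3 h4 h4 <;> first
          | linarith [h.1, h.2]
          | (exfalso; apply h3; constructor <;> linarith [h.1, h.2])
          | (exfalso; apply h4; constructor <;> linarith [h.1, h.2])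
    _ = μ.fst.real {x | |η x - 1/2| ≤ κ} * (2 * κ) := by
        rw [integral_indicator hS]; simp
    _ ≤ (c * κ ^ β) * (2 * κ) := by
        gcongr
        exact hT κ hκ
    _ = 2 * c * κ ^ (1 + β) := by
        rw [Real.rpow_add hκ, Real.rpow_one]; ring
end

section
/- Let X ⊆ ℝ^d, let L > 0 and κ > 0, and let F be a set of functions from X to ℝ, each of which is (L, κ/4)-approximately Lipschitz. Then for every κ' ≥ 2κ, sup_{f ∈ F} e_f(F, κ') ≤ 17 · N(κ'/(8L); X, ‖·‖₂). -/
open MeasureTheory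

/-- `f` is `(L, κ)`-approximately Lipschitz on `X ⊆ ℝ^d` (Euclidean norm):
`|f x − f x'| ≤ L ‖x − x'‖₂ + κ` for all `x, x' ∈ X`. -/
def ApproxLip {d : ℕ} (X : Set (EuclideanSpace ℝ (Fin d))) (L κ : ℝ)
    (f : EuclideanSpace ℝ (Fin d) → ℝ) : Prop :=
  ∀ x ∈ X, ∀ x' ∈ X, |f x - f x'| ≤ L * ‖x - x'‖ + κ

/-- The covering number `N(ι; X, ‖·‖₂)`: the smallest cardinality of a finite subset of
`X` whose closed `ι`-balls cover `X` (equal to `⊤` if no finite cover exists). -/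
noncomputable def coverNum {d : ℕ} (X : Set (EuclideanSpace ℝ (Fin d))) (ι : ℝ) : ℕ∞ :=
  sInf {n : ℕ∞ | ∃ s : Finset (EuclideanSpace ℝ (Fin d)),
    ↑s ⊆ X ∧ (∀ x ∈ X, ∃ y ∈ s, ‖x - y‖ ≤ ι) ∧ (s.card : ℕ∞) = n}

/-- `x^1, …, x^m` is an eluder sequence in `X` for `F` at `f*` and scale `γ`. -/
def IsEluderSeq {d : ℕ} (X : Set (EuclideanSpace ℝ (Fin d)))
    (F : Set (EuclideanSpace ℝ (Fin d) → ℝ)) (fstar : EuclideanSpace ℝ (Fin d) → ℝ)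
    (γ : ℝ) {m : ℕ} (x : Fin m → EuclideanSpace ℝ (Fin d)) : Prop :=
  (∀ i, x i ∈ X) ∧
    ∀ i : Fin m, ∃ g ∈ F, γ < |g (x i) - fstar (x i)| ∧
      (∑ j ∈ Finset.univ.filter (fun j => j < i), (g (x j) - fstar (x j)) ^ 2) ≤ γ ^ 2

/-- `ě_{f*}(F, γ)`: the length of the longest eluder sequence at scale `γ`. -/
noncomputable def eluderPre {d : ℕ} (X : Set (EuclideanSpace ℝ (Fin d)))
    (F : Set (EuclideanSpace ℝ (Fin d) → ℝ)) (fstar : EuclideanSpace ℝ (Fin d) → ℝ)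
    (γ : ℝ) : ℕ∞ :=
  sSup {n : ℕ∞ | ∃ m : ℕ, (m : ℕ∞) = n ∧
    ∃ x : Fin m → EuclideanSpace ℝ (Fin d), IsEluderSeq X F fstar γ x}

/-- The value function eluder dimension `e_{f*}(F, γ0) := sup_{γ > γ0} ě_{f*}(F, γ)`. -/
noncomputable def eluderDim {d : ℕ} (X : Set (EuclideanSpace ℝ (Fin d)))
    (F : Set (EuclideanSpace ℝ (Fin d) → ℝ)) (fstar : EuclideanSpace ℝ (Fin d) → ℝ)
    (γ0 : ℝ) : ℕ∞ :=
  ⨆ (γ : ℝ) (_ : γ0 < γ), eluderPre X F fstar γ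

theorem eluder_len_aux {d : ℕ} (X : Set (EuclideanSpace ℝ (Fin d))) (L κ : ℝ)
    (hL : 0 < L) (hκ : 0 < κ)
    (F : Set (EuclideanSpace ℝ (Fin d) → ℝ))
    (hF : ∀ f ∈ F, ApproxLip X L (κ / 4) f)
    (κ' : ℝ) (hκ' : 2 * κ ≤ κ') (f : EuclideanSpace ℝ (Fin d) → ℝ) (hf : f ∈ F)
    (γ : ℝ) (hγ : κ' < γ) (m : ℕ) (x : Fin m → EuclideanSpace ℝ (Fin d))
    (hx : IsEluderSeq X F f γ x) (s : Finset (EuclideanSpace ℝ (Fin d)))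
    (hs : ∀ x ∈ X, ∃ y ∈ s, ‖x - y‖ ≤ κ' / (8 * L)) : m ≤ 17 * s.card := by
  classical
  obtain ⟨hX, hE⟩ := hx
  choose c hcs hc using fun i => hs (x i) (hX i)
  by_contra hlt
  push Not at hlt
  obtain ⟨y, hy, hcard⟩ := Finset.exists_lt_card_fiber_of_mul_lt_card_of_maps_to
    (s := (Finset.univ : Finset (Fin m))) (t := s) (f := c) (n := 17)
    (fun i _ => hcs i) (by simpa [mul_comm] using hlt)
  set T := Finset.univ.filter (fun i => c i = y) with hT
  have hne : T.Nonempty := Finset.card_pos.1 (by omega)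
  set i := T.max' hne with hi
  have hiT : i ∈ T := T.max'_mem hne
  obtain ⟨g, hg, hbig, hsum⟩ := hE i
  have hsub : T.erase i ⊆ Finset.univ.filter (fun j => j < i) := by
    intro j hj
    rw [Finset.mem_erase] at hj
    simp only [Finset.mem_filter, Finset.mem_univ, true_and]
    exact lt_of_le_of_ne (T.le_max' j hj.2) hj.1
  have hterm : ∀ j ∈ T.erase i, γ ^ 2 / 16 ≤ (g (x j) - f (x j)) ^ 2 := by
    intro j hj
    have hcj : c j = y := by simpa [hT] using (Finset.mem_erase.1 hj).2
    have hci : c i = y := by simpa [hT] using hiT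
    have h1 := hc j
    have h2 := hc i
    rw [hcj] at h1
    rw [hci, norm_sub_rev] at h2
    have h3 : ‖x i - x j‖ ≤ κ' / (4 * L) := by
      have h5 := norm_sub_le_norm_sub_add_norm_sub (x i) y (x j)
      rw [norm_sub_rev (x i) y, norm_sub_rev y (x j)] at h5
      have : κ' / (8 * L) + κ' / (8 * L) = κ' / (4 * L) := by field_simp; ring
      linarith
    have h4 : L * ‖x i - x j‖ ≤ κ' / 4 := by
      calc L * ‖x i - x j‖ ≤ L * (κ' / (4 * L)) := by gcongr
        _ = κ' / 4 := by field_simp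
    have hgl := hF g hg (x i) (hX i) (x j) (hX j)
    have hfl := hF f hf (x i) (hX i) (x j) (hX j)
    have hab : γ / 4 ≤ |g (x j) - f (x j)| := by
      rw [abs_le] at hgl hfl
      rcases lt_abs.1 hbig with h | h
      · exact le_trans (by linarith) (le_abs_self _)
      · exact le_trans (by linarith) (neg_le_abs _)
    rw [← sq_abs (g (x j) - f (x j))]
    have : (γ / 4) ^ 2 ≤ |g (x j) - f (x j)| ^ 2 := by
      have : 0 ≤ γ / 4 := by linarith
      gcongr
    linarith [show (γ / 4) ^ 2 = γ ^ 2 / 16 by ring]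
  have h6 := Finset.card_nsmul_le_sum _ _ _ hterm
  have h7 := Finset.sum_le_sum_of_subset_of_nonneg hsub
    (f := fun j => (g (x j) - f (x j)) ^ 2) (fun _ _ _ => sq_nonneg _)
  have h8 : (17 : ℝ) ≤ ((T.erase i).card : ℝ) := by
    rw [Finset.card_erase_of_mem hiT]
    exact_mod_cast (by omega)
  rw [nsmul_eq_mul] at h6
  have hγ2 : 0 < γ ^ 2 := by
    have : 0 < γ := by linarith
    positivity
  nlinarith

/-- Theorem D.6 of the paper (`eluder_lip_approx`): for a class of
`(L, κ/4)`-approximately Lipschitz functions and any `κ' ≥ 2κ`,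
`sup_{f ∈ F} e_f(F, κ') ≤ 17 · N(κ'/(8L); X, ‖·‖₂)`. -/
theorem stmt6 {d : ℕ} (X : Set (EuclideanSpace ℝ (Fin d))) (L κ : ℝ)
    (hL : 0 < L) (hκ : 0 < κ)
    (F : Set (EuclideanSpace ℝ (Fin d) → ℝ))
    (hF : ∀ f ∈ F, ApproxLip X L (κ / 4) f)
    (κ' : ℝ) (hκ' : 2 * κ ≤ κ') :
    (⨆ f ∈ F, eluderDim X F f κ') ≤ 17 * coverNum X (κ' / (8 * L)) := by
  refine iSup₂_le fun f hf => iSup₂_le fun γ hγ => sSup_le ?_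
  rintro n ⟨m, rfl, x, hx⟩
  rcases Set.eq_empty_or_nonempty {n : ℕ∞ | ∃ s : Finset (EuclideanSpace ℝ (Fin d)),
    ↑s ⊆ X ∧ (∀ x ∈ X, ∃ y ∈ s, ‖x - y‖ ≤ κ' / (8 * L)) ∧ (s.card : ℕ∞) = n} with h | h
  · rw [coverNum, h, sInf_empty, ENat.mul_top (by norm_num)]
    exact le_top
  · obtain ⟨s, -, hs, hcard⟩ := csInf_mem h
    rw [coverNum, ← hcard]
    exact_mod_cast eluder_len_aux X L κ hL hκ F hF κ' hκ' f hf γ hγ m x hx s hs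
end

section
/- Let X ⊆ ℝ^d, let L > 0 and κ > 0, and let F be a set of functions from X to ℝ, each of which is (L, κ/4)-approximately Lipschitz. Fix f ∈ F and κ̄ ≥ 2κ, and let x^1,…,x^m ∈ X be a sequence such that for every i ≤ m there exists f^i ∈ F with |f^i(x^i) − f(x^i)| > κ̄ and Σ_{j<i} (f^i(x^j) − f(x^j))² ≤ κ̄². Then for every x̌ ∈ X, the number of indices i ∈ {1,…,m} with ‖x^i − x̌‖₂ ≤ κ̄/(8L) is at most 17. -/
/-- the per-ball counting claim from the proof of Theorem D.6 of the paper: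
an eluder sequence at scale `κ̄ ≥ 2κ` for an `(L, κ/4)`-approximately Lipschitz class has
at most `17` points in any Euclidean ball of radius `κ̄/(8L)` centered in `X`. -/
theorem stmt7 {d : ℕ} (X : Set (EuclideanSpace ℝ (Fin d))) (L κ : ℝ)
    (hL : 0 < L) (hκ : 0 < κ)
    (F : Set (EuclideanSpace ℝ (Fin d) → ℝ))
    (hF : ∀ f ∈ F, ApproxLip X L (κ / 4) f)
    (f : EuclideanSpace ℝ (Fin d) → ℝ) (hf : f ∈ F)
    (κbar : ℝ) (hκbar : 2 * κ ≤ κbar)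
    (m : ℕ) (x : Fin m → EuclideanSpace ℝ (Fin d)) (hx : ∀ i, x i ∈ X)
    (helu : ∀ i : Fin m, ∃ g ∈ F, κbar < |g (x i) - f (x i)| ∧
      (∑ j ∈ Finset.univ.filter (fun j => j < i), (g (x j) - f (x j)) ^ 2) ≤ κbar ^ 2)
    (xcheck : EuclideanSpace ℝ (Fin d)) (hxcheck : xcheck ∈ X) :
    (Finset.univ.filter (fun i : Fin m => ‖x i - xcheck‖ ≤ κbar / (8 * L))).card ≤ 17 := by
  set S := Finset.univ.filter (fun i : Fin m => ‖x i - xcheck‖ ≤ κbar / (8 * L)) with hS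
  rcases S.eq_empty_or_nonempty with h0 | hne
  · rw [h0]; simp
  have hkb : 0 < κbar := by linarith
  set i := S.max' hne with hi
  have hiS : i ∈ S := S.max'_mem hne
  obtain ⟨g, hg, hbig, hsum⟩ := helu i
  have hmem : ∀ j ∈ S, ‖x j - xcheck‖ ≤ κbar / (8 * L) := by
    intro j hj
    rw [hS] at hj
    exact (Finset.mem_filter.mp hj).2
  have key : ∀ j ∈ S.erase i, κbar ^ 2 / 16 ≤ (g (x j) - f (x j)) ^ 2 := by
    intro j hj
    have h1 := hmem j (Finset.mem_of_mem_erase hj)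
    have h2 := hmem i hiS
    have h3 : ‖x i - x j‖ ≤ ‖x i - xcheck‖ + ‖x j - xcheck‖ := by
      have := norm_sub_le (x i - xcheck) (x j - xcheck)
      simpa using this
    have h4 : L * ‖x i - x j‖ ≤ κbar / 4 := by
      calc L * ‖x i - x j‖ ≤ L * (κbar / (8 * L) + κbar / (8 * L)) :=
            mul_le_mul_of_nonneg_left (by linarith) hL.le
        _ = κbar / 4 := by field_simp; norm_num
    have h5 := abs_le.mp (hF g hg _ (hx i) _ (hx j))
    have h6 := abs_le.mp (hF f hf _ (hx i) _ (hx j))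
    rcases lt_abs.mp hbig with h | h
    · have : κbar / 4 ≤ g (x j) - f (x j) := by linarith [h5.2, h6.1]
      nlinarith
    · have : κbar / 4 ≤ -(g (x j) - f (x j)) := by linarith [h5.1, h6.2]
      nlinarith
  have hsub : S.erase i ⊆ Finset.univ.filter (fun j => j < i) := by
    intro j hj
    rw [Finset.mem_filter]
    exact ⟨Finset.mem_univ _, lt_of_le_of_ne (S.le_max' j (Finset.mem_of_mem_erase hj))
      (Finset.ne_of_mem_erase hj)⟩
  have h7 := Finset.card_nsmul_le_sum _ _ _ key
  have h8 := Finset.sum_le_sum_of_subset_of_nonneg hsub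
    (f := fun j => (g (x j) - f (x j)) ^ 2) (fun j _ _ => sq_nonneg _)
  rw [nsmul_eq_mul] at h7
  have h9 : ((S.erase i).card : ℝ) ≤ 16 := by
    have hp : 0 < κbar ^ 2 := by positivity
    by_contra hc
    push Not at hc
    nlinarith
  have h10 : (S.erase i).card ≤ 16 := by exact_mod_cast h9
  have h11 := Finset.card_erase_add_one hiS
  omega
end

section
/- Let (Ω, 𝔉, P) be a probability space with filtration (𝔉_t)_{t=0,…,T}, and let (X_t)_{t=1,…,T} be real-valued random variables adapted to the filtration with 0 ≤ X_t ≤ B almost surely for some B > 0. Then for every δ ∈ (0,1), with probability at least 1 − δ, simultaneously: Σ_{t=1}^T X_t ≤ (3/2)·Σ_{t=1}^T E[X_t | 𝔉_{t−1}] + 4·B·log(2/δ), and Σ_{t=1}^T E[X_t | 𝔉_{t−1}] ≤ 2·Σ_{t=1}^T X_t + 8·B·log(2/δ). -/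
open MeasureTheory

theorem aux_step {Ω : Type*} {m m0 : MeasurableSpace Ω} (μ : Measure Ω)
    [IsProbabilityMeasure μ] (hm : m ≤ m0) (S X : Ω → ℝ) (a b B C : ℝ)
    (hS : StronglyMeasurable[m] S) (hX : StronglyMeasurable[m0] X)
    (hSC : ∀ᵐ ω ∂μ, |S ω| ≤ C)
    (hXB : ∀ᵐ ω ∂μ, 0 ≤ X ω ∧ X ω ≤ B)
    (hab : ∀ x, 0 ≤ x → x ≤ B → Real.exp (a * x) ≤ 1 + b * x) :
    (∃ C', ∀ᵐ ω ∂μ, |S ω + (a * X ω - b * (μ[X | m]) ω)| ≤ C') ∧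
    ∫ ω, Real.exp (S ω + (a * X ω - b * (μ[X | m]) ω)) ∂μ ≤ ∫ ω, Real.exp (S ω) ∂μ := by
  have hbi : ∀ (f : Ω → ℝ) (K : ℝ), StronglyMeasurable[m0] f → (∀ᵐ ω ∂μ, |f ω| ≤ K) →
      Integrable f μ := fun f K hf hK =>
    Integrable.of_bound hf.aestronglyMeasurable K hK
  have hXi : Integrable X μ := hbi X B hX (by
    filter_upwards [hXB] with ω h
    rw [abs_of_nonneg h.1]; exact h.2)
  have hE0 : ∀ᵐ ω ∂μ, 0 ≤ (μ[X | m]) ω := by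
    have := condExp_nonneg (μ := μ) (m := m) (f := X) (by
      filter_upwards [hXB] with ω h using h.1)
    filter_upwards [this] with ω h using h
  have hEB : ∀ᵐ ω ∂μ, (μ[X | m]) ω ≤ B := by
    have := condExp_mono (μ := μ) (m := m) (f := X) (g := fun _ => B) hXi
      (integrable_const B) (by filter_upwards [hXB] with ω h using h.2)
    rw [condExp_const hm] at this
    exact this
  have hEm : StronglyMeasurable[m] (μ[X | m]) := stronglyMeasurable_condExp
  have hbd : ∀ᵐ ω ∂μ, |S ω + (a * X ω - b * (μ[X | m]) ω)| ≤ C + (|a| * B + |b| * B) := by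
    filter_upwards [hSC, hXB, hE0, hEB] with ω h1 h2 h3 h4
    refine (abs_add_le _ _).trans (add_le_add h1 ((abs_sub _ _).trans ?_))
    rw [abs_mul, abs_mul, abs_of_nonneg h2.1, abs_of_nonneg h3]
    exact add_le_add (mul_le_mul_of_nonneg_left h2.2 (abs_nonneg _))
      (mul_le_mul_of_nonneg_left h4 (abs_nonneg _))
  refine ⟨⟨_, hbd⟩, ?_⟩
  have hexpi : ∀ (f : Ω → ℝ) (K : ℝ), StronglyMeasurable[m0] f → (∀ᵐ ω ∂μ, |f ω| ≤ K) →
      Integrable (fun ω => Real.exp (f ω)) μ := fun f K hf hK =>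
    hbi _ (Real.exp K) (Real.continuous_exp.comp_stronglyMeasurable hf) (by
      filter_upwards [hK] with ω h
      rw [abs_of_pos (Real.exp_pos _)]
      exact Real.exp_le_exp.2 ((le_abs_self _).trans h))
  have hSm0 := hS.mono hm
  have hEm0 := hEm.mono hm
  set G : Ω → ℝ := fun ω => Real.exp (S ω - b * (μ[X | m]) ω) with hG
  set Y : Ω → ℝ := fun ω => Real.exp (a * X ω) with hY
  have hGm : StronglyMeasurable[m] G :=
    Real.continuous_exp.comp_stronglyMeasurable (hS.sub (hEm.const_mul b))
  have hYi : Integrable Y μ := hexpi _ (|a| * B) (hX.const_mul a) (by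
    filter_upwards [hXB] with ω h
    rw [abs_mul, abs_of_nonneg h.1]
    exact mul_le_mul_of_nonneg_left h.2 (abs_nonneg _))
  have hprod : (fun ω => Real.exp (S ω + (a * X ω - b * (μ[X | m]) ω))) = G * Y := by
    funext ω
    simp only [hG, hY, Pi.mul_apply, ← Real.exp_add]
    congr 1; ring
  have hGYi : Integrable (G * Y) μ := by
    rw [← hprod]
    exact hexpi _ _ (hSm0.add ((hX.const_mul a).sub (hEm0.const_mul b))) hbd
  have hpull := condExp_mul_of_stronglyMeasurable_left hGm hGYi hYi
  have hYle : ∀ᵐ ω ∂μ, (μ[Y | m]) ω ≤ 1 + b * (μ[X | m]) ω := by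
    have hi : Integrable (b • X) μ := hXi.smul b
    have h1 := condExp_mono (μ := μ) (m := m) (f := Y) (g := (fun _ => (1:ℝ)) + b • X) hYi
      ((integrable_const 1).add hi) (by
        filter_upwards [hXB] with ω h
        simpa using hab _ h.1 h.2)
    have h2 := condExp_add (μ := μ) (integrable_const (1:ℝ)) hi m
    have h3 := condExp_smul (μ := μ) b X m
    rw [condExp_const hm] at h2
    filter_upwards [h1, h2, h3] with ω h1 h2 h3
    rw [h2] at h1
    simpa [h3] using h1
  rw [hprod, ← integral_condExp hm (f := G * Y)]
  refine integral_mono_ae integrable_condExp (hexpi S C hSm0 hSC) ?_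
  filter_upwards [hpull, hYle] with ω h1 h2
  rw [h1]
  calc G ω * (μ[Y | m]) ω ≤ G ω * Real.exp (b * (μ[X | m]) ω) := by
        refine mul_le_mul_of_nonneg_left ?_ (Real.exp_pos _).le
        have := Real.add_one_le_exp (b * (μ[X | m]) ω)
        linarith
    _ = Real.exp (S ω) := by
        simp only [hG, ← Real.exp_add]; congr 1; ring

theorem aux_tail {Ω : Type*} [m0 : MeasurableSpace Ω] (μ : Measure Ω)
    [IsProbabilityMeasure μ] (T : ℕ) (ℱ : Filtration ℕ m0)
    (Xs : ℕ → Ω → ℝ)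
    (hadp : ∀ t, 1 ≤ t → t ≤ T → StronglyMeasurable[ℱ t] (Xs t))
    (B : ℝ)
    (hbdd : ∀ t, 1 ≤ t → t ≤ T → ∀ᵐ ω ∂μ, 0 ≤ Xs t ω ∧ Xs t ω ≤ B)
    (a b : ℝ) (hab : ∀ x, 0 ≤ x → x ≤ B → Real.exp (a * x) ≤ 1 + b * x) (L : ℝ) :
    μ {ω | L ≤ ∑ t ∈ Finset.Icc 1 T, (a * Xs t ω - b * (μ[Xs t | ℱ (t - 1)]) ω)}
      ≤ ENNReal.ofReal (Real.exp (-L)) := by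
  have key : ∀ n, n ≤ T →
      StronglyMeasurable[ℱ n]
        (fun ω => ∑ t ∈ Finset.Icc 1 n, (a * Xs t ω - b * (μ[Xs t | ℱ (t - 1)]) ω)) ∧
      (∃ C, ∀ᵐ ω ∂μ,
        |∑ t ∈ Finset.Icc 1 n, (a * Xs t ω - b * (μ[Xs t | ℱ (t - 1)]) ω)| ≤ C) ∧
      ∫ ω, Real.exp (∑ t ∈ Finset.Icc 1 n, (a * Xs t ω - b * (μ[Xs t | ℱ (t - 1)]) ω)) ∂μ
        ≤ 1 := by
    intro n
    induction n with
    | zero =>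
      intro _
      refine ⟨?_, ⟨0, ?_⟩, ?_⟩
      · simpa using stronglyMeasurable_const
      · simp
      · simp
    | succ n ih =>
      intro hn
      obtain ⟨h1, ⟨C, h2⟩, h3⟩ := ih (by omega)
      have hX := hadp (n + 1) (by omega) hn
      obtain ⟨h4, h5⟩ := aux_step μ (ℱ.le n) _ (Xs (n + 1)) a b B C h1 (hX.mono (ℱ.le _)) h2
        (hbdd (n + 1) (by omega) hn) hab
      simp only [Finset.sum_Icc_succ_top (Nat.le_add_left 1 n), Nat.add_sub_cancel]
      refine ⟨?_, h4, h5.trans h3⟩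
      have hle : ℱ n ≤ ℱ (n + 1) := ℱ.mono (Nat.le_succ n)
      exact (h1.mono hle).add ((hX.const_mul a).sub
        ((stronglyMeasurable_condExp.mono hle).const_mul b))
  obtain ⟨h1, ⟨C, h2⟩, h3⟩ := key T le_rfl
  set S : Ω → ℝ := fun ω => ∑ t ∈ Finset.Icc 1 T, (a * Xs t ω - b * (μ[Xs t | ℱ (t - 1)]) ω)
    with hS
  have hi : Integrable (fun ω => Real.exp (1 * S ω)) μ := by
    refine Integrable.of_bound (Real.continuous_exp.comp_stronglyMeasurable
      ((h1.mono (ℱ.le T)).const_mul 1)).aestronglyMeasurable (Real.exp C) ?_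
    filter_upwards [h2] with ω h
    rw [Real.norm_of_nonneg (Real.exp_pos _).le, one_mul]
    exact Real.exp_le_exp.2 ((le_abs_self _).trans h)
  have h := ProbabilityTheory.measure_ge_le_exp_mul_mgf (μ := μ) (X := S) L zero_le_one hi
  rw [ProbabilityTheory.mgf] at h
  simp only [one_mul, neg_mul] at h
  have h' : μ.real {ω | L ≤ S ω} ≤ Real.exp (-L) :=
    h.trans (mul_le_of_le_one_right (Real.exp_pos _).le h3)
  rw [← ofReal_measureReal]
  exact ENNReal.ofReal_le_ofReal h'

theorem aux_exp (y : ℝ) (hy : |y| ≤ 1) : Real.exp y ≤ 1 + y + y ^ 2 := by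
  have := (abs_le.1 (Real.abs_exp_sub_one_sub_id_le hy)).2
  linarith

/-- Lemma E.2 of the paper (`martingale_two_sides`): for an adapted
sequence `(X_t)_{t=1,…,T}` with `0 ≤ X_t ≤ B` a.s., with probability at least `1 − δ`,
`Σ X_t ≤ (3/2) Σ E[X_t | 𝔉_{t−1}] + 4 B log(2/δ)` and
`Σ E[X_t | 𝔉_{t−1}] ≤ 2 Σ X_t + 8 B log(2/δ)` simultaneously. -/
theorem stmt10 {Ω : Type*} [m0 : MeasurableSpace Ω] (μ : Measure Ω)
    [IsProbabilityMeasure μ] (T : ℕ) (ℱ : Filtration ℕ m0)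
    (Xs : ℕ → Ω → ℝ)
    (hadp : ∀ t, 1 ≤ t → t ≤ T → StronglyMeasurable[ℱ t] (Xs t))
    (B : ℝ) (hB : 0 < B)
    (hbdd : ∀ t, 1 ≤ t → t ≤ T → ∀ᵐ ω ∂μ, 0 ≤ Xs t ω ∧ Xs t ω ≤ B)
    (δ : ℝ) (hδ0 : 0 < δ) (hδ1 : δ < 1) :
    ENNReal.ofReal (1 - δ) ≤
      μ {ω | (∑ t ∈ Finset.Icc 1 T, Xs t ω ≤
                (3/2) * ∑ t ∈ Finset.Icc 1 T, (μ[Xs t | ℱ (t - 1)]) ω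
                  + 4 * B * Real.log (2 / δ)) ∧
             (∑ t ∈ Finset.Icc 1 T, (μ[Xs t | ℱ (t - 1)]) ω ≤
                2 * ∑ t ∈ Finset.Icc 1 T, Xs t ω + 8 * B * Real.log (2 / δ))} := by
  set L := Real.log (2 / δ) with hL
  have hexpL : Real.exp (-L) = δ / 2 := by
    rw [hL, Real.exp_neg, Real.exp_log (by positivity), inv_div]
  have hy : ∀ x, 0 ≤ x → x ≤ B → 0 ≤ x / (4 * B) ∧ x / (4 * B) ≤ 1 / 4 := by
    intro x h0 h1
    refine ⟨by positivity, ?_⟩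
    rw [div_le_iff₀ (by positivity)]; linarith
  have t1 := aux_tail μ T ℱ Xs hadp B hbdd (1 / (4 * B)) (3 / 2 * (1 / (4 * B))) (by
    intro x h0 h1
    obtain ⟨h2, h3⟩ := hy x h0 h1
    have h4 := aux_exp (x / (4 * B)) (by rw [abs_of_nonneg h2]; linarith)
    have e : 1 / (4 * B) * x = x / (4 * B) := by ring
    rw [mul_assoc, e]
    nlinarith) L
  have t2 := aux_tail μ T ℱ Xs hadp B hbdd (-(1 / (4 * B))) (-(1 / 2 * (1 / (4 * B)))) (by
    intro x h0 h1
    obtain ⟨h2, h3⟩ := hy x h0 h1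
    have h4 := aux_exp (-(x / (4 * B))) (by rw [abs_neg, abs_of_nonneg h2]; linarith)
    have e : 1 / (4 * B) * x = x / (4 * B) := by ring
    rw [neg_mul, neg_mul, mul_assoc, e]
    nlinarith) L
  rw [hexpL] at t1 t2
  simp only [Finset.sum_sub_distrib, ← Finset.mul_sum] at t1 t2
  set good := {ω | (∑ t ∈ Finset.Icc 1 T, Xs t ω ≤
                (3/2) * ∑ t ∈ Finset.Icc 1 T, (μ[Xs t | ℱ (t - 1)]) ω
                  + 4 * B * L) ∧
             (∑ t ∈ Finset.Icc 1 T, (μ[Xs t | ℱ (t - 1)]) ω ≤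
                2 * ∑ t ∈ Finset.Icc 1 T, Xs t ω + 8 * B * L)} with hgood
  set b1 := {ω | L ≤ 1 / (4 * B) * ∑ t ∈ Finset.Icc 1 T, Xs t ω -
    3 / 2 * (1 / (4 * B)) * ∑ t ∈ Finset.Icc 1 T, (μ[Xs t | ℱ (t - 1)]) ω} with hb1
  set b2 := {ω | L ≤ -(1 / (4 * B)) * ∑ t ∈ Finset.Icc 1 T, Xs t ω -
    -(1 / 2 * (1 / (4 * B))) * ∑ t ∈ Finset.Icc 1 T, (μ[Xs t | ℱ (t - 1)]) ω} with hb2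
  have hcov : (Set.univ : Set Ω) ⊆ good ∪ (b1 ∪ b2) := by
    intro ω _
    by_contra hc
    simp only [Set.mem_union, not_or, hb1, hb2, Set.mem_setOf_eq, not_le] at hc
    obtain ⟨hg, h1, h2⟩ := hc
    apply hg
    simp only [hgood, Set.mem_setOf_eq]
    generalize (∑ t ∈ Finset.Icc 1 T, Xs t ω) = x at h1 h2 ⊢
    generalize (∑ t ∈ Finset.Icc 1 T, (μ[Xs t | ℱ (t - 1)]) ω) = e at h1 h2 ⊢
    have g1 : x - 3 / 2 * e < 4 * B * L := by
      have := mul_lt_mul_of_pos_left h1 (show 0 < 4 * B by positivity)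
      have e1 : 4 * B * (1 / (4 * B) * x - 3 / 2 * (1 / (4 * B)) * e) = x - 3 / 2 * e := by
        field_simp
      linarith
    have g2 : e - 2 * x < 8 * B * L := by
      have := mul_lt_mul_of_pos_left h2 (show 0 < 8 * B by positivity)
      have e1 : 8 * B * (-(1 / (4 * B)) * x - -(1 / 2 * (1 / (4 * B))) * e) = e - 2 * x := by
        field_simp
        ring
      linarith
    exact ⟨by linarith, by linarith⟩
  have hfin : (1 : ENNReal) ≤ μ good + ENNReal.ofReal δ := by
    calc (1 : ENNReal) = μ Set.univ := measure_univ.symm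
      _ ≤ μ (good ∪ (b1 ∪ b2)) := measure_mono hcov
      _ ≤ μ good + (μ b1 + μ b2) :=
        (measure_union_le _ _).trans (add_le_add le_rfl (measure_union_le _ _))
      _ ≤ μ good + (ENNReal.ofReal (δ / 2) + ENNReal.ofReal (δ / 2)) :=
        add_le_add le_rfl (add_le_add t1 t2)
      _ = μ good + ENNReal.ofReal δ := by
        rw [← ENNReal.ofReal_add (by positivity) (by positivity), add_halves]
  rw [ENNReal.ofReal_sub _ hδ0.le, ENNReal.ofReal_one]
  exact tsub_le_iff_right.2 hfin
end
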